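/- arXiv:2605.18034 — 7 statements merged into one kernel-verified Lean document; each statement's English description precedes it below -/
import Mathlib

section
/- Let φ : Σ* → Γ* be a non-erasing morphism and let u, v be words over Σ. Then occ(u, v) ≤ occ(φ(u), φ(v)). -/
/-- Extension of a letter map `φ` to a morphism on words. -/
def wlift {α β : Type*} (φ : α → List β) (u : List α) : List β := (u.map φ).flatten

/-- Set of starting positions (0-indexed) of occurrences of `u` in `w`. -/
def Occ {β : Type*} (u w : List β) : Set ℕ := {i | i ≤ w.length ∧ u <+: w.drop i}

/-- Number of occurrences of `u` as a factor of `w`. -/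
noncomputable def occ {β : Type*} (u w : List β) : ℕ := (Occ u w).ncard

theorem wlift_append {α β : Type*} (φ : α → List β) (u v : List α) :
    wlift φ (u ++ v) = wlift φ u ++ wlift φ v := by
  simp [wlift]

theorem length_le_length_wlift {α β : Type*} {φ : α → List β}
    (hne : ∀ c : α, φ c ≠ []) (u : List α) : u.length ≤ (wlift φ u).length := by
  induction u with
  | nil => simp
  | cons a u ih =>
    have h := List.length_pos_iff.mpr (hne a)
    simp only [wlift, List.map_cons, List.flatten_cons, List.length_append,
      List.length_cons] at ih ⊢
    omega

theorem length_wlift_take_lt {α β : Type*} {φ : α → List β}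
    (hne : ∀ c : α, φ c ≠ []) {v : List α} {i j : ℕ} (hij : i < j) (hj : j ≤ v.length) :
    (wlift φ (v.take i)).length < (wlift φ (v.take j)).length := by
  have h := length_le_length_wlift hne ((v.take j).drop i)
  have e : v.take j = v.take i ++ (v.take j).drop i := by
    conv_lhs => rw [← List.take_append_drop i (v.take j)]
    rw [List.take_take, min_eq_left hij.le]
  rw [e, wlift_append, List.length_append]
  simp only [List.length_drop, List.length_take] at h
  omega

theorem finite_Occ {β : Type*} (u w : List β) : (Occ u w).Finite :=
  (Set.finite_Iic w.length).subset fun _ hi => hi.1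

theorem length_wlift_take_mem_Occ {α β : Type*} (φ : α → List β) {u v : List α} {i : ℕ}
    (hi : i ∈ Occ u v) : (wlift φ (v.take i)).length ∈ Occ (wlift φ u) (wlift φ v) := by
  obtain ⟨-, t, ht⟩ := hi
  have e : wlift φ v = wlift φ (v.take i) ++ (wlift φ u ++ wlift φ t) := by
    rw [← wlift_append, ht, ← wlift_append, List.take_append_drop]
  refine ⟨?_, wlift φ t, ?_⟩
  · rw [e, List.length_append]
    exact Nat.le_add_right _ _
  · rw [e, List.drop_left]

theorem occ_le_of_nonErasing {α β : Type*} (φ : α → List β)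
    (hne : ∀ c : α, φ c ≠ [])
    (u v : List α) :
    occ u v ≤ occ (wlift φ u) (wlift φ v) := by
  refine Set.ncard_le_ncard_of_injOn (fun i => (wlift φ (v.take i)).length)
    (fun i hi => length_wlift_take_mem_Occ φ hi) ?_ (finite_Occ _ _)
  intro i hi j hj hij
  rcases lt_trichotomy i j with h | h | h
  · exact absurd hij (length_wlift_take_lt hne h hj.1).ne
  · exact h
  · exact absurd hij (length_wlift_take_lt hne h hi.1).ne'
end

section
/- Let φ : Σ* → Γ* be an injective morphism, let u, v be words over Σ, and let k ≥ 1 be an integer. If φ is interference-free on {φ^i(u) : 0 ≤ i ≤ k−1}, then for every index p with 0 ≤ p ≤ |v|: p ∈ Occ(u, v) if and only if |φ^k(v₍₀..p₎)| ∈ Occ(φ^k(u), φ^k(v)), where v₍₀..p₎ denotes the prefix of v consisting of its first p letters. -/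
/-- `w` admits a `φ`-image factorization. -/
def ImageFact {α β : Type*} (φ : α → List β) (w : List β) : Prop :=
  ∃ s : List α, w = wlift φ s

/-- `w` admits an interfered `φ`-image factorization. -/
def InterferedFact {α β : Type*} (φ : α → List β) (w : List β) : Prop :=
  ∃ x y z : List β, w = x ++ y ++ z ∧
    (∃ c : α, x <:+ φ c ∧ x ≠ φ c) ∧
    ImageFact φ y ∧
    (∃ c' : α, z <+: φ c' ∧ z ≠ φ c') ∧
    x ++ z ≠ []

/-- `w` is an inner `φ`-image factor. -/
def InnerImageFactor {α β : Type*} (φ : α → List β) (w : List β) : Prop :=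
  ∃ c : α, w <:+: φ c ∧ ¬ w <+: φ c ∧ ¬ w <:+ φ c

/-- `φ` is interference-free on the set `L` of words. -/
def InterferenceFree {α β : Type*} (φ : α → List β) (L : Set (List α)) : Prop :=
  ∀ u ∈ L, u ≠ [] →
    ¬ InterferedFact φ (wlift φ u) ∧ ¬ InnerImageFactor φ (wlift φ u)

theorem wlift_iterate_append {α : Type*} (φ : α → List α) (k : ℕ) (u v : List α) :
    (wlift φ)^[k] (u ++ v) = (wlift φ)^[k] u ++ (wlift φ)^[k] v := by
  induction k generalizing u v with
  | zero => rfl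
  | succ k ih => simp only [Function.iterate_succ_apply, wlift_append, ih]

theorem wlift_iterate_prefix {α : Type*} (φ : α → List α) (k : ℕ) {u w : List α}
    (h : u <+: w) : (wlift φ)^[k] u <+: (wlift φ)^[k] w := by
  obtain ⟨t, rfl⟩ := h
  exact ⟨_, (wlift_iterate_append φ k u t).symm⟩

theorem exists_eq_append_of_prefix_wlift {α β : Type*} (φ : α → List β)
    (w : List α) (b : List β) (h : b <+: wlift φ w) :
    ∃ s z, s <+: w ∧ b = wlift φ s ++ z ∧ (z = [] ∨ ∃ c, z <+: φ c ∧ z ≠ φ c) := by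
  induction w generalizing b with
  | nil => exact ⟨[], [], List.prefix_refl _, by simpa [wlift] using h, Or.inl rfl⟩
  | cons a w ih =>
    have ha (l : List α) : wlift φ (a :: l) = φ a ++ wlift φ l := by simp [wlift]
    rw [ha] at h
    rcases List.prefix_or_prefix_of_prefix h (List.prefix_append _ _) with hb | ⟨t, rfl⟩
    · by_cases he : b = φ a
      · exact ⟨[a], [], by simp, by simp [he, wlift], Or.inl rfl⟩
      · exact ⟨[], b, List.nil_prefix, by simp [wlift], Or.inr ⟨a, hb, he⟩⟩
    · obtain ⟨s, z, hs, rfl, hz⟩ := ih t ((List.prefix_append_right_inj _).1 h)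
      exact ⟨a :: s, z, by simpa using hs, by simp [ha], hz⟩

theorem prefix_of_wlift_prefix {α β : Type*} (φ : α → List β)
    (hinj : Function.Injective (wlift φ)) {u w : List α}
    (hu : u ≠ [] → ¬ InterferedFact φ (wlift φ u)) (h : wlift φ u <+: wlift φ w) :
    u <+: w := by
  by_cases hne : u = []
  · simp [hne]
  obtain ⟨s, z, hs, he, hz⟩ := exists_eq_append_of_prefix_wlift φ w _ h
  by_cases hz0 : z = []
  · subst hz0
    rw [List.append_nil] at he
    rwa [hinj he]
  · refine absurd ⟨[], wlift φ s, z, by simpa using he, ?_, ⟨s, rfl⟩,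
      hz.resolve_left hz0, by simpa using hz0⟩ (hu hne)
    obtain ⟨c, -⟩ := List.exists_mem_of_ne_nil u hne
    refine ⟨c, List.nil_suffix, fun hc => ?_⟩
    have : [c] = [] := hinj (by simp [wlift, ← hc])
    simp at this

theorem prefix_of_wlift_iterate_prefix {α : Type*} (φ : α → List α)
    (hinj : Function.Injective (wlift φ)) {u w : List α} (k : ℕ)
    (hu : ∀ i < k, (wlift φ)^[i] u ≠ [] → ¬ InterferedFact φ (wlift φ ((wlift φ)^[i] u)))
    (h : (wlift φ)^[k] u <+: (wlift φ)^[k] w) : u <+: w := by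
  induction k with
  | zero => exact h
  | succ k ih =>
    rw [Function.iterate_succ_apply', Function.iterate_succ_apply'] at h
    exact ih (fun i hi => hu i (by omega)) (prefix_of_wlift_prefix φ hinj (hu k (by omega)) h)

theorem occurrence_bijection {α : Type*} (φ : α → List α)
    (hinj : Function.Injective (wlift φ))
    (u v : List α) (k : ℕ) (hk : 1 ≤ k)
    (hif : InterferenceFree φ {w | ∃ i : ℕ, i < k ∧ w = (wlift φ)^[i] u}) :
    ∀ p : ℕ, p ≤ v.length →
      (p ∈ Occ u v ↔
        ((wlift φ)^[k] (v.take p)).length ∈ Occ ((wlift φ)^[k] u) ((wlift φ)^[k] v)) := by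
  intro p hp
  have hv : (wlift φ)^[k] v = (wlift φ)^[k] (v.take p) ++ (wlift φ)^[k] (v.drop p) := by
    rw [← wlift_iterate_append, List.take_append_drop]
  simp only [Occ, Set.mem_ofPred_eq, hv, List.drop_left, List.length_append]
  constructor
  · rintro ⟨-, h⟩
    exact ⟨by omega, wlift_iterate_prefix φ k h⟩
  · rintro ⟨-, h⟩
    exact ⟨hp, prefix_of_wlift_iterate_prefix φ hinj k
      (fun i hi hne => (hif _ ⟨i, hi, rfl⟩ hne).1) h⟩
end

section
/- An injective morphism φ : Σ* → Γ* is strongly interference-free if and only if φ is interference-free on the set of one-letter words {c : c a letter of Σ}. -/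
theorem wlift_cons {α β : Type*} (φ : α → List β) (a : α) (u : List α) :
    wlift φ (a :: u) = φ a ++ wlift φ u := by
  simp [wlift]

theorem wlift_singleton {α β : Type*} (φ : α → List β) (a : α) : wlift φ [a] = φ a := by
  simp [wlift]

theorem ne_nil_of_injective_wlift {α β : Type*} {φ : α → List β}
    (hinj : Function.Injective (wlift φ)) (a : α) : φ a ≠ [] := by
  intro h
  have : wlift φ [a] = wlift φ [] := by simp [wlift, h]
  simpa using hinj this

/-- A prefix of `φ(s) z`, with `z` a proper prefix of an image, has the same form. -/
theorem exists_eq_wlift_append_of_prefix {α β : Type*} (φ : α → List β) {z : List β}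
    (hz : ∃ c, z <+: φ c ∧ z ≠ φ c) (s : List α) (v : List β) (hv : v <+: wlift φ s ++ z) :
    ∃ s' z', v = wlift φ s' ++ z' ∧ ∃ c, z' <+: φ c ∧ z' ≠ φ c := by
  induction s generalizing v with
  | nil =>
    obtain ⟨c, hc, hne⟩ := hz
    have hv' : v <+: z := by simpa [wlift] using hv
    refine ⟨[], v, by simp [wlift], c, hv'.trans hc, ?_⟩
    rintro rfl
    exact hne (hc.eq_of_length_le hv'.length_le)
  | cons a t ih =>
    rw [wlift_cons, List.append_assoc] at hv
    rcases List.prefix_or_prefix_of_prefix hv (List.prefix_append _ _) with h | ⟨r, rfl⟩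
    · by_cases he : v = φ a
      · obtain ⟨s', z', h', hz'⟩ := ih [] List.nil_prefix
        exact ⟨a :: s', z', by rw [wlift_cons, List.append_assoc, ← h', List.append_nil, he], hz'⟩
      · exact ⟨[], v, by simp [wlift], a, h, he⟩
    · obtain ⟨s', z', rfl, hz'⟩ := ih r ((List.prefix_append_right_inj _).1 hv)
      exact ⟨a :: s', z', by rw [wlift_cons, List.append_assoc], hz'⟩

/-- If `φ` is interference-free on letters, its images form an infix code. -/
theorem eq_of_infix_of_interferenceFree_letters {α β : Type*} {φ : α → List β}
    (hinj : Function.Injective (wlift φ)) (h : InterferenceFree φ {w | ∃ c : α, w = [c]})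
    {a c : α} (hac : φ a <:+: φ c) : φ a = φ c := by
  by_contra hne
  obtain ⟨hI, hF⟩ := h [a] ⟨a, rfl⟩ (by simp)
  rw [wlift_singleton] at hI hF
  have ha := ne_nil_of_injective_wlift hinj
  refine hF ⟨c, hac, fun hp => hI ?_, fun hs => hI ?_⟩
  · exact ⟨[], [], φ a, by simp, ⟨a, List.nil_suffix, (ha a).symm⟩, ⟨[], by simp [wlift]⟩,
      ⟨c, hp, hne⟩, by simpa using ha a⟩
  · exact ⟨φ a, [], [], by simp, ⟨c, hs, hne⟩, ⟨[], by simp [wlift]⟩,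
      ⟨a, List.nil_prefix, (ha a).symm⟩, by simpa using ha a⟩

/-- If the images of `φ` form an infix code, `φ(u) = φ(s) z` with `z` a proper prefix of an image
forces `z = ε`. -/
theorem eq_nil_of_wlift_eq_wlift_append {α β : Type*} {φ : α → List β}
    (hinfix : ∀ a c, φ a <:+: φ c → φ a = φ c) {z : List β}
    (hz : ∃ c, z <+: φ c ∧ z ≠ φ c) (u s : List α) (h : wlift φ u = wlift φ s ++ z) :
    z = [] := by
  induction u generalizing s with
  | nil =>
    have : [] = wlift φ s ++ z := h
    exact (List.append_eq_nil_iff.1 this.symm).2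
  | cons a u ih =>
    rw [wlift_cons] at h
    cases s with
    | nil =>
      obtain ⟨c, hc, hne⟩ := hz
      have hp : φ a <+: z := ⟨wlift φ u, h⟩
      have he := hinfix a c (hp.trans hc).isInfix
      exact absurd (hc.eq_of_length_le (he ▸ hp.length_le)) hne
    | cons b s =>
      rw [wlift_cons, List.append_assoc] at h
      have he : φ a = φ b := by
        rcases List.prefix_or_prefix_of_prefix (List.prefix_append (φ a) (wlift φ u))
          (h ▸ List.prefix_append (φ b) _) with hp | hp
        · exact hinfix a b hp.isInfix
        · exact (hinfix b a hp.isInfix).symm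
      rw [he] at h
      exact ih s (List.append_cancel_left h)

theorem sif_iff_if_on_letters {α β : Type*} (φ : α → List β)
    (hinj : Function.Injective (wlift φ)) :
    InterferenceFree φ Set.univ ↔ InterferenceFree φ {w | ∃ c : α, w = [c]} := by
  refine ⟨fun h u _ => h u trivial, fun h u _ hu => ?_⟩
  have hinfix : ∀ a c, φ a <:+: φ c → φ a = φ c := fun a c hac =>
    eq_of_infix_of_interferenceFree_letters hinj h hac
  obtain ⟨a, u, rfl⟩ := List.exists_cons_of_ne_nil hu
  have hpre : φ a <+: wlift φ (a :: u) := by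
    rw [wlift_cons]
    exact List.prefix_append _ _
  constructor
  · rintro ⟨x, y, z, hw, ⟨c, hc, hne⟩, ⟨s, rfl⟩, hz, hxz⟩
    by_cases hx : x = []
    · subst hx
      exact hxz (eq_nil_of_wlift_eq_wlift_append hinfix hz (a :: u) s hw)
    · rw [List.append_assoc] at hw
      rw [hw] at hpre
      rcases List.prefix_or_prefix_of_prefix hpre (List.prefix_append _ _) with hp | ⟨v, hv⟩
      · have he := hinfix a c (hp.isInfix.trans hc.isInfix)
        exact hne (hc.eq_of_length_le (he ▸ hp.length_le))
      · rw [← hv, List.prefix_append_right_inj] at hpre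
        obtain ⟨s', z', rfl, hz'⟩ := exists_eq_wlift_append_of_prefix φ hz s v hpre
        refine (h [a] ⟨a, rfl⟩ (by simp)).1 ⟨x, wlift φ s', z', ?_, ⟨c, hc, hne⟩, ⟨s', rfl⟩, hz', ?_⟩
        · rw [wlift_singleton, ← hv, List.append_assoc]
        · simp [hx]
  · rintro ⟨c, hin, hnp, -⟩
    have he := hinfix a c (hpre.isInfix.trans hin)
    exact hnp (hin.eq_of_length_le (he ▸ hpre.length_le) ▸ List.prefix_rfl)
end

section
/- The Fibonacci morphism φ is interference-free on the set {F_i : i ≥ 4 and i is even}. -/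
/-- The binary alphabet. -/
inductive Ltr : Type
  | a : Ltr
  | b : Ltr

/-- The Fibonacci morphism: a ↦ ab, b ↦ a. -/
def fib : Ltr → List Ltr
  | Ltr.a => [Ltr.a, Ltr.b]
  | Ltr.b => [Ltr.a]

/-- The Fibonacci word of order `i`: `F i = φ^{i-1}(b)`. -/
def F (i : ℕ) : List Ltr := (wlift fib)^[i - 1] [Ltr.b]

/-- Fibonacci words of even order end with the letter `a`. -/
theorem F_even_eq_append_a (k : ℕ) : ∃ v, F (2 * k + 2) = v ++ [Ltr.a] := by
  induction k with
  | zero => exact ⟨[], rfl⟩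
  | succ k ih =>
    obtain ⟨v, hv⟩ := ih
    have hstep : F (2 * (k + 1) + 2) = wlift fib (wlift fib (F (2 * k + 2))) := by
      change (wlift fib)^[2 * k + 1 + 1 + 1] [Ltr.b] = _
      rw [Function.iterate_succ_apply', Function.iterate_succ_apply']
      rfl
    refine ⟨wlift fib (wlift fib v) ++ [Ltr.a, Ltr.b], ?_⟩
    rw [hstep, hv, wlift_append, wlift_append, List.append_assoc]
    rfl

theorem head?_wlift_fib {u : List Ltr} (hu : u ≠ []) : (wlift fib u).head? = some Ltr.a := by
  cases u with
  | nil => exact absurd rfl hu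
  | cons c u => cases c <;> rfl

theorem proper_suffix_fib {x : List Ltr} {c : Ltr} (h : x <:+ fib c) (hne : x ≠ fib c) :
    x = [] ∨ x = [Ltr.b] := by
  cases c <;> simp only [fib, List.suffix_cons_iff, List.suffix_nil] at h hne <;> tauto

theorem proper_prefix_fib {z : List Ltr} {c : Ltr} (h : z <+: fib c) (hne : z ≠ fib c) :
    z = [] ∨ z = [Ltr.a] := by
  cases c <;> simp only [fib, List.prefix_cons_iff, List.prefix_nil] at h hne <;> aesop

theorem not_innerImageFactor_fib (w : List Ltr) : ¬ InnerImageFactor fib w := by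
  rintro ⟨c, hw, hpre, hsuf⟩
  cases c <;>
    simp only [fib, List.infix_cons_iff, List.infix_nil, List.suffix_cons_iff,
      List.suffix_nil, List.prefix_cons_iff, List.prefix_nil] at hw hpre hsuf <;>
    aesop

theorem fib_if_even :
    InterferenceFree fib {w | ∃ i : ℕ, 4 ≤ i ∧ i % 2 = 0 ∧ w = F i} := by
  rintro u ⟨i, hi, heven, rfl⟩ hne
  refine ⟨?_, not_innerImageFactor_fib _⟩
  rintro ⟨x, y, z, hw, ⟨c, hx, hxne⟩, -, ⟨c', hz, hzne⟩, hxz⟩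
  have hhead := head?_wlift_fib hne
  have hlast : (wlift fib (F i)).getLast? = some Ltr.b := by
    obtain ⟨k, rfl⟩ : ∃ k, i = 2 * k + 2 := ⟨i / 2 - 1, by omega⟩
    obtain ⟨v, hv⟩ := F_even_eq_append_a k
    rw [hv, wlift_append]
    simp [wlift, fib]
  rw [hw] at hhead hlast
  rcases proper_suffix_fib hx hxne with rfl | rfl
  · rcases proper_prefix_fib hz hzne with rfl | rfl
    · exact hxz rfl
    · simp at hlast
  · simp at hhead
end

section
/- The Thue-Morse morphism μ is interference-free on the set {T_i : i ≥ 4}. -/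
/-- The Thue-Morse morphism: a ↦ ab, b ↦ ba. -/
def tm : Ltr → List Ltr
  | Ltr.a => [Ltr.a, Ltr.b]
  | Ltr.b => [Ltr.b, Ltr.a]

/-- The Thue-Morse word of order `i`: `T i = μ^{i-1}(a)`. -/
def T (i : ℕ) : List Ltr := (wlift tm)^[i - 1] [Ltr.a]

theorem length_tm (c : Ltr) : (tm c).length = 2 := by cases c <;> rfl

theorem wlift_tm_cons (c : Ltr) (s : List Ltr) :
    wlift tm (c :: s) = tm c ++ wlift tm s := by simp [wlift]

theorem length_wlift_tm (s : List Ltr) : (wlift tm s).length = 2 * s.length := by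
  induction s with
  | nil => rfl
  | cons c s ih =>
    rw [wlift_tm_cons, List.length_append, length_tm, ih, List.length_cons]
    ring

theorem wlift_tm_iterate_prefix (n : ℕ) :
    ∃ r, (wlift tm)^[n + 1] [Ltr.a] = Ltr.a :: Ltr.b :: r := by
  induction n with
  | zero => exact ⟨[], rfl⟩
  | succ n ih =>
    obtain ⟨r, hr⟩ := ih
    rw [Function.iterate_succ_apply', hr, wlift_tm_cons]
    exact ⟨_, rfl⟩

theorem tm_if :
    InterferenceFree tm {w | ∃ i : ℕ, 4 ≤ i ∧ w = T i} := by
  rintro u ⟨i, hi, rfl⟩ -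
  obtain ⟨r, hr⟩ : ∃ r, T i = Ltr.a :: Ltr.b :: r := by
    obtain ⟨n, rfl⟩ := Nat.exists_eq_add_of_le' hi
    exact wlift_tm_iterate_prefix (n + 2)
  rw [hr]
  have hlen := length_wlift_tm (Ltr.a :: Ltr.b :: r)
  constructor
  · rintro ⟨x, y, z, hw, ⟨c, hx, hxc⟩, ⟨s, rfl⟩, ⟨d, hz, hzd⟩, hne⟩
    have hx1 : x.length < 2 := by
      rw [← length_tm c]
      exact lt_of_le_of_ne hx.length_le fun h => hxc (hx.eq_of_length h)
    have hz1 : z.length < 2 := by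
      rw [← length_tm d]
      exact lt_of_le_of_ne hz.length_le fun h => hzd (hz.eq_of_length h)
    have hne' : x.length + z.length ≠ 0 := by
      rw [← List.length_append]
      exact fun h => hne (List.length_eq_zero_iff.mp h)
    have hsum := hlen
    rw [hw, List.length_append, List.length_append, length_wlift_tm, List.length_cons,
      List.length_cons] at hsum
    obtain ⟨p, rfl⟩ : ∃ p, x = [p] := List.length_eq_one_iff.mp (by omega)
    rw [wlift_tm_cons, wlift_tm_cons] at hw
    cases s with
    | nil => simp at hsum; omega
    | cons e s =>
      cases e <;> simp [wlift_tm_cons, tm] at hw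
  · rintro ⟨c, hin, -, -⟩
    have := hin.length_le
    rw [hlen, length_tm] at this
    simp at this
end

section
/- For every odd integer i ≥ 5, the word φ(F_i) admits an interfered φ-image factorization, where φ is the Fibonacci morphism; in particular, φ is not interference-free on the set {F_i : i ≥ 5 and i is odd}. -/
/-- An even number of applications of the Fibonacci morphism to `b` gives a word ending in `b`. -/
theorem exists_wlift_fib_iterate_eq_append_b (k : ℕ) :
    ∃ s, (wlift fib)^[2 * k] [Ltr.b] = s ++ [Ltr.b] := by
  induction k with
  | zero => exact ⟨[], rfl⟩
  | succ k ih =>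
    obtain ⟨s, hs⟩ := ih
    refine ⟨wlift fib (wlift fib s) ++ [Ltr.a], ?_⟩
    rw [show 2 * (k + 1) = 2 * k + 1 + 1 by ring, Function.iterate_succ_apply',
      Function.iterate_succ_apply', hs, wlift_append, wlift_append]
    simp [wlift, fib]

theorem exists_F_eq_append_b {i : ℕ} (hi : i % 2 = 1) : ∃ s, F i = s ++ [Ltr.b] := by
  have h : i - 1 = 2 * (i / 2) := by omega
  rw [F, h]
  exact exists_wlift_fib_iterate_eq_append_b _

theorem interferedFact_wlift_fib_append_b (s : List Ltr) :
    InterferedFact fib (wlift fib (s ++ [Ltr.b])) :=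
  ⟨[], wlift fib s, [Ltr.a], by rw [wlift_append]; simp [wlift, fib],
    ⟨Ltr.a, by simp [fib]⟩, ⟨s, rfl⟩, ⟨Ltr.a, by simp [fib]⟩, by simp⟩

theorem fib_not_if_odd :
    (∀ i : ℕ, 5 ≤ i → i % 2 = 1 → InterferedFact fib (wlift fib (F i))) ∧
    ¬ InterferenceFree fib {w | ∃ i : ℕ, 5 ≤ i ∧ i % 2 = 1 ∧ w = F i} := by
  have key : ∀ i : ℕ, i % 2 = 1 → InterferedFact fib (wlift fib (F i)) := by
    intro i hi
    obtain ⟨s, hs⟩ := exists_F_eq_append_b hi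
    rw [hs]
    exact interferedFact_wlift_fib_append_b s
  refine ⟨fun i _ hi => key i hi, fun h => ?_⟩
  obtain ⟨s, hs⟩ := exists_F_eq_append_b (i := 5) rfl
  exact (h (F 5) ⟨5, le_rfl, rfl, rfl⟩ (by simp [hs])).1 (key 5 rfl)
end

section
/- The Fibonacci morphism φ is interference-free on the set {F_i^◁ : i ≥ 5 and i is odd}, where F_i^◁ denotes the Fibonacci word F_i with its last letter removed. -/
/-- The image of a nonempty word under the Fibonacci morphism starts with `a`. -/
theorem exists_wlift_fib_eq_cons {u : List Ltr} (hu : u ≠ []) :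
    ∃ t, wlift fib u = Ltr.a :: t := by
  rcases u with _ | ⟨c, u⟩
  · exact absurd rfl hu
  · cases c <;> simp [wlift, fib]

/-- Fibonacci words of odd order at least three end with `ab`. -/
theorem exists_F_odd_eq_append (k : ℕ) : ∃ p, F (2 * k + 3) = p ++ [Ltr.a, Ltr.b] := by
  induction k with
  | zero => exact ⟨[], by simp [F, wlift, fib]⟩
  | succ k ih =>
    obtain ⟨p, hp⟩ := ih
    have h : F (2 * (k + 1) + 3) = wlift fib (wlift fib (F (2 * k + 3))) := by
      simp only [F, ← Function.iterate_succ_apply']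
      rfl
    refine ⟨wlift fib (wlift fib p) ++ [Ltr.a, Ltr.b, Ltr.a], ?_⟩
    rw [h, hp, wlift_append, wlift_append]
    simp [wlift, fib]

/-- The Fibonacci image of a word ending with `a` starts with `a` and ends with `b`, which rules out
interfered factorizations. -/
theorem not_interferedFact_wlift_fib (v : List Ltr) :
    ¬ InterferedFact fib (wlift fib (v ++ [Ltr.a])) := by
  rintro ⟨x, y, z, h, ⟨c, hx, hxc⟩, -, ⟨d, hz, hzd⟩, hne⟩
  have hx' : x = [] ∨ x = [Ltr.b] := by
    cases c <;> simp [fib, List.suffix_cons_iff] at hx hxc <;> grind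
  have hz' : z = [] ∨ z = [Ltr.a] := by
    cases d <;> simp [fib, List.prefix_cons_iff] at hz hzd <;> grind
  obtain ⟨t, ht⟩ := exists_wlift_fib_eq_cons (u := v ++ [Ltr.a]) (by simp)
  have hlast := congrArg List.getLast? h
  rw [wlift_append] at hlast
  rw [ht] at h
  rcases hx' with rfl | rfl
  · rcases hz' with rfl | rfl
    · exact hne rfl
    · simp [wlift, fib] at hlast
  · simp at h

theorem fib_if_lhd_odd :
    InterferenceFree fib {w | ∃ i : ℕ, 5 ≤ i ∧ i % 2 = 1 ∧ w = (F i).dropLast} := by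
  rintro _ ⟨i, hi, hodd, rfl⟩ -
  obtain ⟨k, rfl⟩ : ∃ k, i = 2 * k + 3 := ⟨(i - 3) / 2, by omega⟩
  obtain ⟨p, hp⟩ := exists_F_odd_eq_append k
  have hu : (F (2 * k + 3)).dropLast = p ++ [Ltr.a] := by
    rw [hp, List.dropLast_append_of_ne_nil (by simp)]
    rfl
  rw [hu]
  exact ⟨not_interferedFact_wlift_fib p, not_innerImageFactor_fib _⟩
end
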